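/- Let C be a cycle in a finite connected graph with Hamiltonian H and Metropolis dynamics, with bottom F(C) = P a stable plateau, and let η₀ ∈ F(C). Then the quantity Γ̃(C) = max_{η ∈ C \ {η₀}} (Φ_C(η, η₀) − H(η)) equals 0, where Φ_C denotes the communication height computed with paths restricted to stay inside C; equivalently, from every η ∈ C there is a path inside C to η₀ along which H is non-increasing except possibly for moves within level sets (precisely: there is a path from η to η₀ inside C of height exactly H(η)). -/

import Mathlib

variable {Ω : Type*}

def SetConnected (adj : Ω → Ω → Prop) (A : Set Ω) : Prop :=
  ∀ η ∈ A, ∀ ξ ∈ A, ∃ ω : List Ω, ω.Chain' adj ∧ ω.head? = some η ∧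
    ω.getLast? = some ξ ∧ ∀ x ∈ ω, x ∈ A

def outerBoundary (adj : Ω → Ω → Prop) (A : Set Ω) : Set Ω :=
  {ξ | ξ ∉ A ∧ ∃ η ∈ A, adj η ξ}

def IsCycle (adj : Ω → Ω → Prop) (H : Ω → ℝ) (A : Set Ω) : Prop :=
  A.Nonempty ∧ SetConnected adj A ∧
    ∀ η ∈ A, ∀ ξ ∈ outerBoundary adj A, H η < H ξ

def IsStablePlateau (adj : Ω → Ω → Prop) (H : Ω → ℝ) (A : Set Ω) : Prop :=
  A.Nonempty ∧ SetConnected adj A ∧ (∀ η ∈ A, ∀ ξ ∈ A, H η = H ξ) ∧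
    ∀ ζ ∈ outerBoundary adj A, ∀ η ∈ A, H η < H ζ

noncomputable def setCommHeight (adj : Ω → Ω → Prop) (H : Ω → ℝ) (A B : Set Ω) : ℝ :=
  sInf {h : ℝ | ∃ ω : List Ω, ω.Chain' adj ∧ (∃ η ∈ A, ω.head? = some η) ∧
    (∃ ξ ∈ B, ω.getLast? = some ξ) ∧ ∀ x ∈ ω, H x ≤ h}

/-- Adjacency between two configurations of `A`. -/
def adjWithin (adj : Ω → Ω → Prop) (A : Set Ω) (x y : Ω) : Prop :=
  adj x y ∧ x ∈ A ∧ y ∈ A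

instance adjWithin_symm {adj : Ω → Ω → Prop} [Std.Symm adj] (A : Set Ω) :
    Std.Symm (adjWithin adj A) :=
  ⟨fun _ _ h => ⟨symm h.1, h.2.2, h.2.1⟩⟩

theorem adjWithin_mono {adj : Ω → Ω → Prop} {A B : Set Ω} (hAB : A ⊆ B) {x y : Ω}
    (h : Relation.ReflTransGen (adjWithin adj A) x y) :
    Relation.ReflTransGen (adjWithin adj B) x y :=
  Relation.ReflTransGen.mono (fun _ _ h => ⟨h.1, hAB h.2.1, hAB h.2.2⟩) _ _ h

theorem mem_of_reflTransGen_adjWithin {adj : Ω → Ω → Prop} {A : Set Ω} {x y : Ω} (hx : x ∈ A)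
    (h : Relation.ReflTransGen (adjWithin adj A) x y) : y ∈ A := by
  induction h with
  | refl => exact hx
  | tail _ h _ => exact h.2.2

theorem exists_path_of_reflTransGen {adj : Ω → Ω → Prop} {A : Set Ω} {x y : Ω} (hy : y ∈ A)
    (h : Relation.ReflTransGen (adjWithin adj A) x y) :
    ∃ ω : List Ω, ω.IsChain adj ∧ ω.head? = some x ∧ ω.getLast? = some y ∧ ∀ z ∈ ω, z ∈ A := by
  induction h using Relation.ReflTransGen.head_induction_on with
  | refl => exact ⟨[y], by simp, rfl, rfl, by simpa using hy⟩
  | @head a c hac _ ih =>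
    obtain ⟨ω, hch, hhead, hlast, hmem⟩ := ih
    cases ω with
    | nil => simp at hhead
    | cons d l =>
      obtain rfl : d = c := by simpa using hhead
      refine ⟨a :: d :: l, List.isChain_cons_cons.2 ⟨hac.1, hch⟩, rfl, ?_, ?_⟩
      · rw [List.getLast?_cons_cons, hlast]
      · exact List.forall_mem_cons.2 ⟨hac.2.1, hmem⟩

theorem reflTransGen_of_path {adj : Ω → Ω → Prop} {A : Set Ω} {y : Ω} (ω : List Ω) :
    ∀ x : Ω, ω.IsChain adj → ω.head? = some x → ω.getLast? = some y → (∀ z ∈ ω, z ∈ A) →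
      Relation.ReflTransGen (adjWithin adj A) x y := by
  induction ω with
  | nil => intro x _ h; simp at h
  | cons d l ih =>
    intro x hch hhead hlast hmem
    obtain rfl : d = x := by simpa using hhead
    cases l with
    | nil =>
      obtain rfl : d = y := by simpa using hlast
      exact .refl
    | cons e l =>
      rw [List.isChain_cons_cons] at hch
      rw [List.getLast?_cons_cons] at hlast
      have hmem' := (List.forall_mem_cons.1 hmem).2
      exact .head ⟨hch.1, hmem d (by simp), hmem' e (by simp)⟩ (ih e hch.2 rfl hlast hmem')

/-- The part of a level set of `H` in a cycle that is reachable from a configuration `m` is a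
stable plateau as soon as `m` minimizes `H` among the configurations of the cycle reachable from
`m` without exceeding the height `H m`. -/
theorem isStablePlateau_level_component {adj : Ω → Ω → Prop} [Std.Symm adj] {H : Ω → ℝ}
    {C : Set Ω} (hcyc : IsCycle adj H C) {m : Ω} (hm : m ∈ C)
    (hmin : ∀ x, Relation.ReflTransGen (adjWithin adj {x | x ∈ C ∧ H x ≤ H m}) m x → H m ≤ H x) :
    IsStablePlateau adj H
      {x | Relation.ReflTransGen (adjWithin adj {x | x ∈ C ∧ H x ≤ H m}) m x} := by
  set L : Set Ω := {x | x ∈ C ∧ H x ≤ H m} with hL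
  set Q : Set Ω := {x | Relation.ReflTransGen (adjWithin adj L) m x} with hQ
  have hmL : m ∈ L := ⟨hm, le_rfl⟩
  have hQL : ∀ x ∈ Q, x ∈ L := fun x hx => mem_of_reflTransGen_adjWithin hmL hx
  have hHQ : ∀ x ∈ Q, H x = H m := fun x hx => le_antisymm (hQL x hx).2 (hmin x hx)
  have hwithin : ∀ x ∈ Q, Relation.ReflTransGen (adjWithin adj Q) m x := by
    intro x hx
    induction (show Relation.ReflTransGen (adjWithin adj L) m x from hx) with
    | refl => exact .refl
    | tail hb hbc ih => exact (ih hb).tail ⟨hbc.1, hb, hb.tail hbc⟩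
  refine ⟨⟨m, .refl⟩, fun x hx y hy => ?_, fun x hx y hy => (hHQ x hx).trans (hHQ y hy).symm, ?_⟩
  · exact exists_path_of_reflTransGen hy
      (Relation.ReflTransGen.trans (symm (hwithin x hx)) (hwithin y hy))
  · rintro ζ ⟨hζ, q, hq, hqζ⟩ x hx
    rw [hHQ x hx]
    by_cases hζC : ζ ∈ C
    · by_contra hle
      exact hζ (Relation.ReflTransGen.tail hq ⟨hqζ, hQL q hq, hζC, not_lt.1 hle⟩)
    · exact hcyc.2.2 m hm ζ ⟨hζC, q, (hQL q hq).1, hqζ⟩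

/-- for a valley-type cycle `C = {η : Φ(P, η) − H(P) < Γ}` whose bottom
is the single stable plateau `P` (and containing no other stable plateau), the inner
relaxation barrier `Γ̃(C)` vanishes: from every `η ∈ C` there is a path inside `C` to
`η₀ ∈ F(C) = P` of height exactly `H(η)` (i.e. along which `H ≤ H(η)`). -/
theorem inner_barrier_zero [Fintype Ω] (adj : Ω → Ω → Prop) (hsym : Symmetric adj)
    (H : Ω → ℝ)
    (P : Set Ω) (hP : IsStablePlateau adj H P)
    (vP : ℝ) (hvP : ∀ η ∈ P, H η = vP)
    (Γ : ℝ) (hΓpos : 0 < Γ)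
    (C : Set Ω) (hC : C = {η | setCommHeight adj H P {η} - vP < Γ})
    (hcyc : IsCycle adj H C)
    (hbottom : {η | η ∈ C ∧ ∀ ξ ∈ C, H η ≤ H ξ} = P)
    (honly : ∀ Q : Set Ω, IsStablePlateau adj H Q → Q ⊆ C → Q ⊆ P)
    (η₀ : Ω) (hη₀ : η₀ ∈ P) :
    ∀ η ∈ C, ∃ ω : List Ω, ω.Chain' adj ∧ ω.head? = some η ∧
      ω.getLast? = some η₀ ∧ (∀ x ∈ ω, x ∈ C) ∧ ∀ x ∈ ω, H x ≤ H η := by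
  intro η hη
  have : Std.Symm adj := ⟨fun _ _ h => hsym h⟩
  set S : Set Ω := {x | x ∈ C ∧ H x ≤ H η} with hS
  have hηS : η ∈ S := ⟨hη, le_rfl⟩
  obtain ⟨m, hηm, hmin⟩ := Set.exists_min_image
    {x | Relation.ReflTransGen (adjWithin adj S) η x} H (Set.toFinite _) ⟨η, .refl⟩
  have hmS : m ∈ S := mem_of_reflTransGen_adjWithin hηS hηm
  have hLS : {x | x ∈ C ∧ H x ≤ H m} ⊆ S := fun x hx => ⟨hx.1, hx.2.trans hmS.2⟩
  have hQ := isStablePlateau_level_component hcyc hmS.1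
    fun x hx => hmin x (Relation.ReflTransGen.trans hηm (adjWithin_mono hLS hx))
  have hmL : m ∈ {x | x ∈ C ∧ H x ≤ H m} := ⟨hmS.1, le_rfl⟩
  have hmP : m ∈ P :=
    honly _ hQ (fun x hx => (mem_of_reflTransGen_adjWithin hmL hx).1) Relation.ReflTransGen.refl
  have hPS : P ⊆ S := by
    intro x hx
    rw [← hbottom] at hx
    exact ⟨hx.1, hx.2 η hη⟩
  obtain ⟨ω, hch, hhead, hlast, hmem⟩ := hP.2.1 m hmP η₀ hη₀
  have hmη₀ := adjWithin_mono hPS (reflTransGen_of_path ω m hch hhead hlast hmem)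
  obtain ⟨ω', hch', hhead', hlast', hmem'⟩ :=
    exists_path_of_reflTransGen (hPS hη₀) (Relation.ReflTransGen.trans hηm hmη₀)
  exact ⟨ω', hch', hhead', hlast', fun x hx => (hmem' x hx).1, fun x hx => (hmem' x hx).2⟩
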